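/- With the assumptions of the Fixed Count Steps setting (Full NSC(k), uniform cost probability p₀ above target t, positive weights), the function steps_u(·,t) is monotonically increasing: for all t ≤ k₁ ≤ k₂ ≤ k, steps_u(k₁,t) ≤ steps_u(k₂,t). -/

import Mathlib

open Finset

/-- A sequence solving the normalized recurrence with antitone nonnegative weights does not
decrease from `m` to `m + 1` if its previous values are at most `s m`. -/
theorem le_succ_of_weighted_recurrence (w p s : ℕ → ℝ) (m : ℕ)
    (hp : ∀ i, 0 ≤ p i) (hw : ∀ d, d ≤ m → w (d + 1) ≤ w d)
    (hs : ∀ i, i ≤ m → s i ≤ s m) (hpm : p (m + 1) = p m)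
    (hA : 0 < ∑ i ∈ Icc 1 (m + 1), w (m + 1 - i) * p i)
    (hm : w 0 * p m * s m + ∑ i ∈ Icc 1 m, w (m - i) * p i * (s m - s i) = 1)
    (hm' : (∑ i ∈ Icc 1 (m + 1), w (m + 1 - i) * p i) * s (m + 1) =
      1 + ∑ i ∈ Icc 1 m, w (m + 1 - i) * p i * s i) :
    s m ≤ s (m + 1) := by
  have hle : ∑ i ∈ Icc 1 m, w (m + 1 - i) * p i * (s m - s i) ≤
      ∑ i ∈ Icc 1 m, w (m - i) * p i * (s m - s i) := by
    refine sum_le_sum fun i hi => ?_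
    have him := (mem_Icc.mp hi).2
    have h := hw (m - i) (Nat.sub_le m i)
    rw [← Nat.sub_add_comm him] at h
    exact mul_le_mul_of_nonneg_right (mul_le_mul_of_nonneg_right h (hp i))
      (sub_nonneg.mpr (hs i him))
  have hsplit : (∑ i ∈ Icc 1 (m + 1), w (m + 1 - i) * p i) * s m =
      w 0 * p m * s m + ∑ i ∈ Icc 1 m, w (m + 1 - i) * p i * (s m - s i) +
        ∑ i ∈ Icc 1 m, w (m + 1 - i) * p i * s i := by
    rw [sum_Icc_succ_top (by omega), add_mul, sum_mul, hpm, Nat.sub_self, add_assoc,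
      ← sum_add_distrib, add_comm]
    congr 1
    exact sum_congr rfl fun i _ => by ring
  refine le_of_mul_le_mul_left ?_ hA
  linarith

theorem stmt14 (r : ℕ → ℕ → ℝ) (pu : ℕ → ℝ) (p₀ : ℝ) (t k : ℕ)
    (stepsu : ℕ → ℝ)
    (ht : t < k) (hp₀ : 0 < p₀)
    (hpu : ∀ i, 0 ≤ pu i)
    (hpu_hi : ∀ i, t < i → pu i = p₀)
    (hpu_lo : ∀ i, i ≤ t → pu i ≤ p₀)
    (hfull : ∀ k₁ δ₁ k₂ δ₂, δ₁ ≤ k₁ → δ₁ ≤ δ₂ → δ₂ ≤ k₂ → k₂ ≤ k →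
      r k₂ δ₂ ≤ r k₁ δ₁)
    (hrpos : ∀ δ, δ ≤ k → 0 < r k δ)
    (hbase : ∀ m, m ≤ t → stepsu m = 0)
    (hrec : ∀ m, t < m → m ≤ k →
      stepsu m = (1 / ∑ i ∈ Icc 1 m, r m (m - i) * pu i) *
        (1 + ∑ i ∈ Icc (t + 1) (m - 1), p₀ * r m (m - i) * stepsu i)) :
    ∀ k₁ k₂, t ≤ k₁ → k₁ ≤ k₂ → k₂ ≤ k → stepsu k₁ ≤ stepsu k₂ := by
  have hr : ∀ m d, d ≤ m → m ≤ k → r m d = r k d := fun m d hd hm =>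
    le_antisymm (hfull k d m d (hd.trans hm) le_rfl hd hm)
      (hfull m d k d hd le_rfl (hd.trans hm) le_rfl)
  have hA : ∀ m, t < m → m ≤ k → 0 < ∑ i ∈ Icc 1 m, r k (m - i) * pu i := fun m hm hmk =>
    sum_pos' (fun i _ => mul_nonneg (hrpos _ ((Nat.sub_le m i).trans hmk)).le (hpu i))
      ⟨m, mem_Icc.mpr ⟨by omega, le_rfl⟩,
        mul_pos (hrpos _ ((Nat.sub_le m m).trans hmk)) (by rw [hpu_hi m hm]; exact hp₀)⟩
  have hnorm : ∀ m, t < m → m ≤ k →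
      (∑ i ∈ Icc 1 m, r k (m - i) * pu i) * stepsu m =
        1 + ∑ i ∈ Icc 1 (m - 1), r k (m - i) * pu i * stepsu i := by
    intro m hm hmk
    have h₁ : ∑ i ∈ Icc 1 m, r m (m - i) * pu i = ∑ i ∈ Icc 1 m, r k (m - i) * pu i :=
      sum_congr rfl fun i _ => by rw [hr m _ (Nat.sub_le m i) hmk]
    have h₂ : ∑ i ∈ Icc (t + 1) (m - 1), p₀ * r m (m - i) * stepsu i =
        ∑ i ∈ Icc 1 (m - 1), r k (m - i) * pu i * stepsu i := by
      rw [← sum_subset (Icc_subset_Icc_left (Nat.le_add_left 1 t))]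
      · refine sum_congr rfl fun i hi => ?_
        rw [hr m _ (Nat.sub_le m i) hmk, hpu_hi i (mem_Icc.mp hi).1, mul_comm p₀]
      · intro i hi hi'
        rw [hbase i (by simp only [mem_Icc] at hi hi'; omega), mul_zero]
    rw [hrec m hm hmk, h₁, h₂, ← mul_assoc, mul_one_div_cancel (hA m hm hmk).ne', one_mul]
  have hmono : ∀ m, t ≤ m → m ≤ k → ∀ i, i ≤ m → stepsu i ≤ stepsu m := by
    intro m htm
    induction m, htm using Nat.le_induction with
    | base => intro _ i hi; rw [hbase i hi, hbase t le_rfl]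
    | succ m htm ih =>
      intro hmk
      have ih := ih (Nat.le_of_succ_le hmk)
      have hstep : stepsu m ≤ stepsu (m + 1) := by
        rcases htm.eq_or_lt with rfl | htm
        · have h := hnorm (t + 1) (Nat.lt_succ_self t) hmk
          have hzero : ∑ i ∈ Icc 1 (t + 1 - 1), r k (t + 1 - i) * pu i * stepsu i = 0 :=
            sum_eq_zero fun i hi => by rw [hbase i (mem_Icc.mp hi).2, mul_zero]
          rw [hzero, add_zero] at h
          rw [hbase t le_rfl]
          exact (pos_of_mul_pos_right (h.symm ▸ one_pos)
            (hA (t + 1) (Nat.lt_succ_self t) hmk).le).le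
        · refine le_succ_of_weighted_recurrence (r k) pu stepsu m hpu
            (fun d hd => hfull k d k (d + 1) (by omega) (by omega) (by omega) le_rfl) ih
            (by rw [hpu_hi m htm, hpu_hi (m + 1) (by omega)]) (hA _ (by omega) hmk) ?_
            (hnorm (m + 1) (by omega) hmk)
          have h := hnorm m htm (by omega)
          obtain ⟨n, rfl⟩ : ∃ n, m = n + 1 := ⟨m - 1, by omega⟩
          rw [sum_Icc_succ_top (by omega), Nat.add_sub_cancel] at h
          rw [sum_Icc_succ_top (by omega)]
          simp only [mul_sub, sum_sub_distrib, ← sum_mul, Nat.sub_self] at h ⊢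
          linarith
      intro i hi
      rcases hi.eq_or_lt with rfl | hi
      · exact le_rfl
      · exact (ih i (Nat.lt_succ_iff.mp hi)).trans hstep
  exact fun k₁ k₂ h₁ h₂ h₃ => hmono k₂ (h₁.trans h₂) h₃ k₁ h₂
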